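/- Let (M, dist) be a metric space and let P ⊆ M be a set of n ≥ 1 points. For x ∈ M define s(x) = inf{s ≥ 0 : |P ∩ B(x, s)| > n/2}, and let x* ∈ P be a point minimizing s(x) over x ∈ P. Let α > 0 and suppose that sup_{t ≥ s(x*)} (t − s(x*)) · |P \ B(x*, t)| / n ≥ α · sup_{t ≥ 0} t·Ψ_M(P, t). Then the map f : M → ℝ defined by f(x) = dist(x*, x) is 1-Lipschitz and satisfies sup_{t ≥ 0} t·Ψ_ℝ(f(P), t) ≥ α · sup_{t ≥ 0} t·Ψ_M(P, t), where Ψ_ℝ(f(P), t) = |{(x,y) ∈ P×P : |f(x) − f(y)| > t}| / n²; that is, f has weak average distortion at most 1/α with respect to P. -/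

import Mathlib

open Finset
open scoped Classical

/-- `Ψ_M(P, t) = |{(x,y) ∈ P×P : dist(x,y) > t}| / n²` where `n = |P|`. -/
noncomputable def Psi {M : Type*} [MetricSpace M] (P : Finset M) (t : ℝ) : ℝ :=
  (((P ×ˢ P).filter fun z => t < dist z.1 z.2).card : ℝ) / (P.card : ℝ) ^ 2

/-- `Ψ_N(f(P), t) = |{(x,y) ∈ P×P : dist(f x, f y) > t}| / n²`. -/
noncomputable def PsiMap {M N : Type*} [MetricSpace M] [MetricSpace N]
    (f : M → N) (P : Finset M) (t : ℝ) : ℝ :=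
  (((P ×ˢ P).filter fun z => t < dist (f z.1) (f z.2)).card : ℝ) / (P.card : ℝ) ^ 2

lemma median_ball {M : Type*} [MetricSpace M] (P : Finset M) (hP : P.Nonempty) (x : M) (S : ℝ)
    (hS : S = sInf {r : ℝ | 0 ≤ r ∧
        (P.card : ℝ) / 2 < ((P.filter fun y => dist y x ≤ r).card : ℝ)}) :
    (P.card : ℝ) / 2 < ((P.filter fun y => dist y x ≤ S).card : ℝ) := by
  have hpos : (0 : ℝ) < P.card := by exact_mod_cast hP.card_pos
  have hne : {r : ℝ | 0 ≤ r ∧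
        (P.card : ℝ) / 2 < ((P.filter fun y => dist y x ≤ r).card : ℝ)}.Nonempty := by
    refine ⟨∑ y ∈ P, dist y x, Finset.sum_nonneg fun _ _ => dist_nonneg, ?_⟩
    rw [Finset.filter_true_of_mem]
    · linarith
    · intro y hy
      exact Finset.single_le_sum (f := fun y => dist y x) (fun _ _ => dist_nonneg) hy
  by_cases hE : (P.filter fun y => S < dist y x).Nonempty
  · obtain ⟨m, hm, hmin⟩ := Finset.exists_min_image _ (fun y => dist y x) hE
    rw [Finset.mem_filter] at hm
    obtain ⟨r, hr, hrm⟩ := exists_lt_of_csInf_lt hne (hS ▸ hm.2)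
    refine hr.2.trans_le ?_
    norm_cast
    apply Finset.card_le_card
    intro y hy
    rw [Finset.mem_filter] at hy ⊢
    refine ⟨hy.1, ?_⟩
    by_contra! h
    have := hmin y (Finset.mem_filter.2 ⟨hy.1, h⟩)
    linarith [hy.2]
  · rw [Finset.filter_true_of_mem]
    · linarith
    · intro y hy
      by_contra! h
      exact hE ⟨y, Finset.mem_filter.2 ⟨hy, h⟩⟩

lemma psiMap_bdd {M : Type*} [MetricSpace M] (P : Finset M) (f : M → ℝ) :
    BddAbove {v : ℝ | ∃ t : ℝ, 0 ≤ t ∧ v = t * PsiMap f P t} := by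
  refine ⟨∑ z ∈ P ×ˢ P, dist (f z.1) (f z.2), ?_⟩
  rintro v ⟨t, ht, rfl⟩
  have hD : 0 ≤ ∑ z ∈ P ×ˢ P, dist (f z.1) (f z.2) := Finset.sum_nonneg fun _ _ => dist_nonneg
  by_cases h : t ≤ ∑ z ∈ P ×ˢ P, dist (f z.1) (f z.2)
  · have h1 : PsiMap f P t ≤ 1 := by
      unfold PsiMap
      apply div_le_one_of_le₀ _ (by positivity)
      rw [pow_two]
      norm_cast
      rw [← Finset.card_product]
      exact Finset.card_filter_le _ _
    nlinarith
  · have : PsiMap f P t = 0 := by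
      unfold PsiMap
      rw [Finset.filter_false_of_mem]
      · simp
      · intro z hz hlt
        have := Finset.single_le_sum (f := fun z : M × M => dist (f z.1) (f z.2))
          (fun _ _ => dist_nonneg) hz
        linarith
    rw [this]; simpa using hD

lemma psiMap_lower {M : Type*} [MetricSpace M] (P : Finset M) (hP : P.Nonempty) (x : M)
    (S t : ℝ) (hSt : S ≤ t)
    (hS : (P.card : ℝ) / 2 < ((P.filter fun y => dist y x ≤ S).card : ℝ)) :
    ((P.filter fun y => t < dist y x).card : ℝ) / (P.card : ℝ) ≤
      PsiMap (fun y : M => dist x y) P (t - S) := by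
  have hpos : (0 : ℝ) < P.card := by exact_mod_cast hP.card_pos
  set A := P.filter fun y => dist y x ≤ S with hA
  set B := P.filter fun y => t < dist y x with hB
  have hdis : Disjoint (A ×ˢ B) (B ×ˢ A) := by
    rw [Finset.disjoint_left]
    rintro ⟨a, b⟩ h1 h2
    simp only [hA, hB, Finset.mem_product, Finset.mem_filter] at h1 h2
    linarith [h1.1.2, h2.1.2]
  have hsub : A ×ˢ B ∪ B ×ˢ A ⊆
      (P ×ˢ P).filter fun z => t - S < dist (dist x z.1) (dist x z.2) := by
    rintro ⟨a, b⟩ h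
    simp only [hA, hB, Finset.mem_union, Finset.mem_product, Finset.mem_filter] at h ⊢
    rw [Real.dist_eq, dist_comm x a, dist_comm x b]
    rcases h with h | h
    · refine ⟨⟨h.1.1, h.2.1⟩, lt_abs.2 (Or.inr ?_)⟩
      linarith [h.1.2, h.2.2]
    · refine ⟨⟨h.1.1, h.2.1⟩, lt_abs.2 (Or.inl ?_)⟩
      linarith [h.1.2, h.2.2]
  have hc := Finset.card_le_card hsub
  rw [Finset.card_union_of_disjoint hdis, Finset.card_product, Finset.card_product] at hc
  have hc' : (A.card : ℝ) * B.card + B.card * A.card ≤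
      (((P ×ˢ P).filter fun z => t - S < dist (dist x z.1) (dist x z.2)).card : ℝ) := by
    exact_mod_cast hc
  unfold PsiMap
  rw [div_le_div_iff₀ hpos (by positivity)]
  have hB0 : (0 : ℝ) ≤ B.card := by positivity
  have h2 : (P.card : ℝ) * B.card ≤
      (((P ×ˢ P).filter fun z => t - S < dist (dist x z.1) (dist x z.2)).card : ℝ) := by
    nlinarith
  have := mul_le_mul_of_nonneg_right h2 hpos.le
  calc _ = (P.card : ℝ) * B.card * P.card := by ring
    _ ≤ _ := this

/-- If the distance to the "median point" `x*` of `P` spreads the points well, then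
`f(x) = dist(x*, x)` is a 1-Lipschitz embedding of `M` into `ℝ` with weak average
distortion at most `1/α` with respect to `P`. -/
theorem stmt7 {M : Type*} [MetricSpace M] (P : Finset M) (hP : P.Nonempty)
    (s : M → ℝ)
    (hs : ∀ x : M, s x =
      sInf {r : ℝ | 0 ≤ r ∧
        (P.card : ℝ) / 2 < ((P.filter fun y => dist y x ≤ r).card : ℝ)})
    (xstar : M) (hx : xstar ∈ P) (hmin : ∀ x ∈ P, s xstar ≤ s x)
    (α : ℝ) (hα : 0 < α)
    (hcond :
      sSup {v : ℝ | ∃ t : ℝ, s xstar ≤ t ∧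
          v = (t - s xstar) * ((P.filter fun y => t < dist y xstar).card : ℝ) / (P.card : ℝ)} ≥
        α * sSup {v : ℝ | ∃ t : ℝ, 0 ≤ t ∧ v = t * Psi P t}) :
    LipschitzWith 1 (fun x : M => dist xstar x) ∧
    sSup {v : ℝ | ∃ t : ℝ, 0 ≤ t ∧ v = t * PsiMap (fun x : M => dist xstar x) P t} ≥
      α * sSup {v : ℝ | ∃ t : ℝ, 0 ≤ t ∧ v = t * Psi P t} := by
  refine ⟨LipschitzWith.dist_right xstar, hcond.le.trans ?_⟩
  have hm := median_ball P hP xstar (s xstar) (hs xstar)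
  refine csSup_le ⟨_, s xstar, le_rfl, rfl⟩ ?_
  rintro v ⟨t, ht, rfl⟩
  have h1 := psiMap_lower P hP xstar (s xstar) t ht hm
  have h0 : 0 ≤ t - s xstar := sub_nonneg.2 ht
  refine le_trans ?_ (le_csSup (psiMap_bdd P _) ⟨t - s xstar, h0, rfl⟩)
  rw [mul_div_assoc]
  exact mul_le_mul_of_nonneg_left h1 h0
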